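/- Let u, v : ℝ³ ∖ {0} → ℝ be smooth and homogeneous of degree 0. Then ∫_{S²} tr( J_x H_u(x) H_v(x) ) dS = 0. (This realizes the identity ∫_{S²} ε^{AC} ∇_A∇_B u ∇_C∇^B v = 0 on the round sphere, used in the proof that the cross term in the news-squared integral vanishes.) -/

import Mathlib

open MeasureTheory Matrix

noncomputable section

/-- Euclidean 3-space. -/
abbrev E3 := EuclideanSpace ℝ (Fin 3)

/-- The Euclidean inner product on coordinate vectors. -/
def dot3 (a b : Fin 3 → ℝ) : ℝ := ∑ i, a i * b i

/-- The cross product in ℝ³. -/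
def cross3 (a b : Fin 3 → ℝ) : Fin 3 → ℝ :=
  ![a 1 * b 2 - a 2 * b 1, a 2 * b 0 - a 0 * b 2, a 0 * b 1 - a 1 * b 0]

/-- Standard basis vectors of E3. -/
def e3 (i : Fin 3) : E3 := EuclideanSpace.single i 1

/-- The ambient gradient of `u : ℝ³ → ℝ` (as a coordinate vector). -/
def grad3 (u : E3 → ℝ) (x : E3) : Fin 3 → ℝ := fun i => fderiv ℝ u x (e3 i)

/-- The ambient Hessian matrix of `u : ℝ³ → ℝ`. -/
def hess3 (u : E3 → ℝ) (x : E3) : Matrix (Fin 3) (Fin 3) ℝ :=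
  Matrix.of fun i j => iteratedFDeriv ℝ 2 u x ![e3 i, e3 j]

/-- The ambient Euclidean Laplacian Δu = Σᵢ ∂²u/∂xᵢ². -/
def lap3 (u : E3 → ℝ) : E3 → ℝ := fun x => ∑ i, hess3 u x i i

/-- The orthogonal projection P(x) = I - x xᵀ onto the tangent plane of S² at x. -/
def proj3 (x : E3) : Matrix (Fin 3) (Fin 3) ℝ := 1 - Matrix.of fun i j => x i * x j

/-- The projected ambient Hessian H_u(x) = P(x) (D²u)(x) P(x), realizing the intrinsic
Hessian on S² of the restriction of a degree-0 homogeneous function. -/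
def hessS (u : E3 → ℝ) (x : E3) : Matrix (Fin 3) (Fin 3) ℝ := proj3 x * hess3 u x * proj3 x

/-- The matrix of the linear map `w ↦ x × w` on ℝ³. -/
def crossMat (x : E3) : Matrix (Fin 3) (Fin 3) ℝ :=
  !![0, -x 2, x 1; x 2, 0, -x 0; -x 1, x 0, 0]

/-- `u` is (positively) homogeneous of degree 0 away from the origin. -/
def Homog0 (u : E3 → ℝ) : Prop := ∀ c : ℝ, 0 < c → ∀ x : E3, x ≠ 0 → u (c • x) = u x

open Metric Real

/-- Polar coordinates in the plane with the angle in `[-π, π]`. -/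
lemma exists_polar_angle (a b : ℝ) :
    ∃ θ ∈ Set.Icc (-π) π, √(a ^ 2 + b ^ 2) * cos θ = a ∧ √(a ^ 2 + b ^ 2) * sin θ = b := by
  have hn : ‖(⟨a, b⟩ : ℂ)‖ = √(a ^ 2 + b ^ 2) := by
    rw [Complex.norm_eq_sqrt_sq_add_sq]
  refine ⟨Complex.arg ⟨a, b⟩, ⟨(Complex.neg_pi_lt_arg _).le, Complex.arg_le_pi _⟩, ?_, ?_⟩
  · rw [← hn, Complex.norm_mul_cos_arg]
  · rw [← hn, Complex.norm_mul_sin_arg]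

lemma sum_sq_of_mem_sphere {x : E3} (hx : x ∈ sphere (0 : E3) 1) :
    x 0 ^ 2 + x 1 ^ 2 + x 2 ^ 2 = 1 := by
  have h := EuclideanSpace.norm_sq_eq x
  rw [mem_sphere_zero_iff_norm.mp hx] at h
  simp [Fin.sum_univ_three] at h
  linarith

lemma ne_zero_of_mem_sphere_one {x : E3} (hx : x ∈ sphere (0 : E3) 1) : x ≠ 0 :=
  ne_zero_of_mem_unit_sphere ⟨x, hx⟩

/-- Spherical coordinates. -/
def sphericalCoord (p : Fin 2 → ℝ) : E3 :=
  !₂[cos (p 1) * cos (p 0), cos (p 1) * sin (p 0), sin (p 1)]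

lemma contDiff_sphericalCoord : ContDiff ℝ 1 sphericalCoord := by
  rw [contDiff_euclidean]
  intro i
  fin_cases i <;> simp [sphericalCoord] <;> fun_prop

lemma sphere_subset_image_sphericalCoord :
    sphere (0 : E3) 1 ⊆ sphericalCoord '' Set.Icc (fun _ => -π) (fun _ => π) := by
  intro x hx
  obtain ⟨θ, hθ, h0, h1⟩ := exists_polar_angle (x 0) (x 1)
  obtain ⟨φ, hφ, hr, h2⟩ := exists_polar_angle (√(x 0 ^ 2 + x 1 ^ 2)) (x 2)
  rw [sq_sqrt (by positivity), sum_sq_of_mem_sphere hx, sqrt_one, one_mul] at hr h2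
  refine ⟨![θ, φ], ⟨fun i => ?_, fun i => ?_⟩, ?_⟩
  · fin_cases i
    exacts [hθ.1, hφ.1]
  · fin_cases i
    exacts [hθ.2, hφ.2]
  · ext i
    fin_cases i <;> simp [sphericalCoord, hr, h0, h1, h2]

lemma hausdorffMeasure_sphere_lt_top : μH[2] (sphere (0 : E3) 1) < ⊤ := by
  obtain ⟨K, hK⟩ := contDiff_sphericalCoord.contDiffOn.exists_lipschitzOnWith one_ne_zero
    (convex_Icc (fun _ : Fin 2 => -π) (fun _ => π)) isCompact_Icc
  have hvol : (μH[2] : Measure (Fin 2 → ℝ)) = volume := by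
    simpa using hausdorffMeasure_pi_real (ι := Fin 2)
  refine (measure_mono sphere_subset_image_sphericalCoord).trans_lt
    ((hK.hausdorffMeasure_image_le zero_le_two).trans_lt ?_)
  rw [hvol]
  exact ENNReal.mul_lt_top (ENNReal.rpow_lt_top_of_nonneg zero_le_two ENNReal.coe_ne_top)
    isCompact_Icc.measure_lt_top

instance isFiniteMeasure_restrict_sphere :
    IsFiniteMeasure ((μH[2] : Measure E3).restrict (sphere (0 : E3) 1)) :=
  isFiniteMeasure_restrict.mpr hausdorffMeasure_sphere_lt_top.ne

lemma integrableOn_sphere {f : E3 → ℝ} (hf : ContinuousOn f {(0 : E3)}ᶜ) :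
    IntegrableOn f (sphere (0 : E3) 1) μH[2] := by
  have h := ContinuousOn.integrableOn_compact (μ := (μH[2] : Measure E3).restrict (sphere 0 1))
    (isCompact_sphere (0 : E3) 1) (hf.mono fun x hx => ne_zero_of_mem_sphere_one hx)
  rwa [IntegrableOn, Measure.restrict_restrict isClosed_sphere.measurableSet,
    Set.inter_self] at h

/-- The generator of the rotations in the coordinate plane spanned by `e3 i` and `e3 j`. -/
def rotGen (i j : Fin 3) (x : E3) : E3 := x i • e3 j - x j • e3 i

/-- The rotation by the angle `t` in the coordinate plane spanned by `e3 i` and `e3 j`. -/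
def rotMap (i j : Fin 3) (t : ℝ) : E3 →ₗ[ℝ] E3 where
  toFun x := x + ((cos t - 1) * x i - sin t * x j) • e3 i
    + (sin t * x i + (cos t - 1) * x j) • e3 j
  map_add' x y := by
    ext k
    simp
    ring
  map_smul' c x := by
    ext k
    simp
    ring

lemma rotMap_apply (i j : Fin 3) (t : ℝ) (x : E3) :
    rotMap i j t x = x + ((cos t - 1) * x i - sin t * x j) • e3 i
      + (sin t * x i + (cos t - 1) * x j) • e3 j := rfl

lemma norm_rotMap {i j : Fin 3} (hij : i ≠ j) (t : ℝ) (x : E3) : ‖rotMap i j t x‖ = ‖x‖ := by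
  rw [← sq_eq_sq₀ (norm_nonneg _) (norm_nonneg _), EuclideanSpace.norm_sq_eq,
    EuclideanSpace.norm_sq_eq]
  have h := sin_sq_add_cos_sq t
  simp only [Fin.sum_univ_three, Real.norm_eq_abs, sq_abs, rotMap_apply]
  fin_cases i <;> fin_cases j <;> simp [e3] at hij ⊢ <;> grind

lemma hasDerivAt_rotMap {i j : Fin 3} (hij : i ≠ j) (t : ℝ) (x : E3) :
    HasDerivAt (fun s => rotMap i j s x) (rotGen i j (rotMap i j t x)) t := by
  have hc := (hasDerivAt_cos t).sub_const 1
  have hs := hasDerivAt_sin t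
  have h := (((hc.mul_const (x i)).sub (hs.mul_const (x j))).smul_const (e3 i)).const_add x |>.add
    (((hs.mul_const (x i)).add (hc.mul_const (x j))).smul_const (e3 j))
  refine h.congr_deriv ?_
  ext k
  fin_cases i <;> fin_cases j <;> fin_cases k <;> simp [e3, rotGen, rotMap_apply] at hij ⊢ <;> ring

/-- `rotMap` as a linear isometric automorphism. -/
def rotIso {i j : Fin 3} (hij : i ≠ j) (t : ℝ) : E3 ≃ₗᵢ[ℝ] E3 :=
  LinearIsometry.toLinearIsometryEquiv ⟨rotMap i j t, norm_rotMap hij t⟩ rfl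

lemma setIntegral_sphere_rotMap {i j : Fin 3} (hij : i ≠ j) (t : ℝ) (h : E3 → ℝ) :
    ∫ x in sphere (0 : E3) 1, h (rotMap i j t x) ∂μH[2] = ∫ x in sphere (0 : E3) 1, h x ∂μH[2] := by
  have hmp := (rotIso hij t).toIsometryEquiv.measurePreserving_hausdorffMeasure 2
  have hpre : (rotIso hij t).toIsometryEquiv ⁻¹' sphere (0 : E3) 1 = sphere (0 : E3) 1 := by
    ext x
    simp
  have := hmp.setIntegral_preimage_emb
    (rotIso hij t).toIsometryEquiv.toHomeomorph.measurableEmbedding h (sphere (0 : E3) 1)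
  rw [hpre] at this
  exact this

lemma rotMap_mem_sphere {i j : Fin 3} (hij : i ≠ j) (t : ℝ) {x : E3}
    (hx : x ∈ sphere (0 : E3) 1) : rotMap i j t x ∈ sphere (0 : E3) 1 := by
  rw [mem_sphere_zero_iff_norm] at hx ⊢
  rw [norm_rotMap hij, hx]

lemma continuous_rotGen (i j : Fin 3) : Continuous (rotGen i j) := by
  unfold rotGen
  fun_prop

lemma continuousOn_fderiv_rotGen {h : E3 → ℝ} (hh : ContDiffOn ℝ 1 h {(0 : E3)}ᶜ) (i j : Fin 3) :
    ContinuousOn (fun x => fderiv ℝ h x (rotGen i j x)) {(0 : E3)}ᶜ :=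
  (hh.continuousOn_fderiv_of_isOpen isOpen_compl_singleton le_rfl).clm_apply
    (continuous_rotGen i j).continuousOn

/-- The derivative of a function along an infinitesimal rotation integrates to zero over the
sphere. -/
lemma integral_fderiv_rotGen {h : E3 → ℝ} (hh : ContDiffOn ℝ 1 h {(0 : E3)}ᶜ) (i j : Fin 3) :
    ∫ x in sphere (0 : E3) 1, fderiv ℝ h x (rotGen i j x) ∂μH[2] = 0 := by
  by_cases hij : i = j
  · simp [hij, rotGen]
  have hcont := continuousOn_fderiv_rotGen hh i j
  obtain ⟨C, hC⟩ := (isCompact_sphere (0 : E3) 1).exists_bound_of_continuousOn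
    (hcont.mono fun x hx => ne_zero_of_mem_sphere_one hx)
  have hrot0 (x : E3) : rotMap i j 0 x = x := by simp [rotMap_apply]
  have key := hasDerivAt_integral_of_dominated_loc_of_deriv_le
    (μ := (μH[2] : Measure E3).restrict (sphere (0 : E3) 1)) (x₀ := (0 : ℝ))
    (F := fun t x => h (rotMap i j t x))
    (F' := fun t x => fderiv ℝ h (rotMap i j t x) (rotGen i j (rotMap i j t x)))
    (bound := fun _ => C) Filter.univ_mem
    (Filter.Eventually.of_forall fun t => ?_) ?_ ?_ ?_ (integrable_const C) ?_
  · have h1 := key.2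
    simp only [setIntegral_sphere_rotMap hij, hrot0] at h1
    exact h1.unique (hasDerivAt_const _ _)
  · refine ContinuousOn.aestronglyMeasurable ?_ isClosed_sphere.measurableSet
    exact hh.continuousOn.comp (LinearMap.continuous_of_finiteDimensional _).continuousOn
      fun x hx => ne_zero_of_mem_sphere_one (rotMap_mem_sphere hij t hx)
  · simp only [hrot0]
    exact integrableOn_sphere hh.continuousOn
  · simpa only [hrot0] using (integrableOn_sphere hcont).aestronglyMeasurable
  · filter_upwards [ae_restrict_mem isClosed_sphere.measurableSet] with x hx t _
    exact hC _ (rotMap_mem_sphere hij t hx)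
  · filter_upwards [ae_restrict_mem isClosed_sphere.measurableSet] with x hx t _
    have hd : DifferentiableAt ℝ h (rotMap i j t x) :=
      (hh.differentiableOn one_ne_zero).differentiableAt (isOpen_compl_singleton.mem_nhds
        (ne_zero_of_mem_sphere_one (rotMap_mem_sphere hij t hx)))
    exact hd.hasFDerivAt.comp_hasDerivAt t (hasDerivAt_rotMap hij t x)

lemma fderiv_rotGen (h : E3 → ℝ) (i j : Fin 3) (x : E3) :
    fderiv ℝ h x (rotGen i j x) = x i * grad3 h x j - x j * grad3 h x i := by
  simp [rotGen, grad3]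

lemma eq_sum_smul_e3 (w : E3) : w = ∑ i, w i • e3 i := by
  ext k
  fin_cases k <;> simp [e3, Fin.sum_univ_three]

lemma fderiv_apply_eq_sum_grad3 (u : E3 → ℝ) (x w : E3) :
    fderiv ℝ u x w = ∑ i, w i * grad3 u x i := by
  refine (congrArg (fderiv ℝ u x) (eq_sum_smul_e3 w)).trans ?_
  simp [grad3]

lemma contDiffOn_fderiv {u : E3 → ℝ} (hu : ContDiffOn ℝ (⊤ : ℕ∞) u {(0 : E3)}ᶜ) :
    ContDiffOn ℝ (⊤ : ℕ∞) (fderiv ℝ u) {(0 : E3)}ᶜ :=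
  hu.fderiv_of_isOpen isOpen_compl_singleton (by simp)

lemma contDiffOn_grad3 {u : E3 → ℝ} (hu : ContDiffOn ℝ (⊤ : ℕ∞) u {(0 : E3)}ᶜ) (i : Fin 3) :
    ContDiffOn ℝ (⊤ : ℕ∞) (fun x => grad3 u x i) {(0 : E3)}ᶜ :=
  (contDiffOn_fderiv hu).clm_apply contDiffOn_const

lemma differentiableAt_of_smooth {F : Type*} [NormedAddCommGroup F] [NormedSpace ℝ F]
    {f : E3 → F} (hf : ContDiffOn ℝ (⊤ : ℕ∞) f {(0 : E3)}ᶜ)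
    {x : E3} (hx : x ≠ 0) : DifferentiableAt ℝ f x :=
  (hf.contDiffAt (isOpen_compl_singleton.mem_nhds hx)).differentiableAt (by simp)

lemma hess3_apply (u : E3 → ℝ) (x : E3) (i j : Fin 3) :
    hess3 u x i j = fderiv ℝ (fderiv ℝ u) x (e3 i) (e3 j) := by
  simp [hess3, iteratedFDeriv_two_apply]

lemma grad3_grad3 {u : E3 → ℝ} (hu : ContDiffOn ℝ (⊤ : ℕ∞) u {(0 : E3)}ᶜ) {x : E3} (hx : x ≠ 0)
    (i j : Fin 3) : grad3 (fun y => grad3 u y j) x i = hess3 u x i j := by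
  rw [hess3_apply]
  unfold grad3
  rw [fderiv_clm_apply (differentiableAt_of_smooth (contDiffOn_fderiv hu) hx)
    (differentiableAt_const _)]
  simp

lemma hess3_comm {u : E3 → ℝ} (hu : ContDiffOn ℝ (⊤ : ℕ∞) u {(0 : E3)}ᶜ) {x : E3} (hx : x ≠ 0)
    (i j : Fin 3) : hess3 u x i j = hess3 u x j i := by
  rw [hess3_apply, hess3_apply]
  exact (hu.contDiffAt (isOpen_compl_singleton.mem_nhds hx)).isSymmSndFDerivAt
    (by simpa using WithTop.coe_le_coe.mpr (le_top : (2 : ℕ∞) ≤ ⊤)) _ _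

lemma grad3_mul {f g : E3 → ℝ} {x : E3} (hf : DifferentiableAt ℝ f x)
    (hg : DifferentiableAt ℝ g x) (i : Fin 3) :
    grad3 (fun y => f y * g y) x i = f x * grad3 g x i + g x * grad3 f x i := by
  simp [grad3, fderiv_fun_mul hf hg]

/-- Euler's identity in degree zero. -/
lemma Homog0.fderiv_self {u : E3 → ℝ} (hu0 : Homog0 u)
    (hu : ContDiffOn ℝ (⊤ : ℕ∞) u {(0 : E3)}ᶜ) {x : E3} (hx : x ≠ 0) : fderiv ℝ u x x = 0 := by
  have h1 : HasDerivAt (fun c : ℝ => u (c • x)) (fderiv ℝ u x x) 1 := by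
    have hd : HasFDerivAt u (fderiv ℝ u x) ((1 : ℝ) • x) := by
      rw [one_smul]
      exact (differentiableAt_of_smooth hu hx).hasFDerivAt
    have hs : HasDerivAt (fun c : ℝ => c • x) x 1 := by
      simpa using (hasDerivAt_id (1 : ℝ)).smul_const x
    exact hd.comp_hasDerivAt 1 hs
  refine h1.unique ((hasDerivAt_const 1 (u x)).congr_of_eventuallyEq ?_)
  filter_upwards [lt_mem_nhds one_pos] with c hc
  exact hu0 c hc x hx

lemma Homog0.sum_grad3 {u : E3 → ℝ} (hu0 : Homog0 u)
    (hu : ContDiffOn ℝ (⊤ : ℕ∞) u {(0 : E3)}ᶜ) {x : E3} (hx : x ≠ 0) :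
    ∑ i, x i * grad3 u x i = 0 := by
  rw [← fderiv_apply_eq_sum_grad3, hu0.fderiv_self hu hx]

/-- The derivative of Euler's identity: the gradient is homogeneous of degree `-1`. -/
lemma Homog0.sum_hess3 {u : E3 → ℝ} (hu0 : Homog0 u)
    (hu : ContDiffOn ℝ (⊤ : ℕ∞) u {(0 : E3)}ᶜ) {x : E3} (hx : x ≠ 0) (i : Fin 3) :
    ∑ j, hess3 u x i j * x j = -grad3 u x i := by
  have h : (fun y => fderiv ℝ u y y) =ᶠ[nhds x] fun _ => 0 := by
    filter_upwards [isOpen_compl_singleton.mem_nhds hx] with y hy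
    exact hu0.fderiv_self hu hy
  have h2 := congrArg (fun L : E3 →L[ℝ] ℝ => L (e3 i)) h.fderiv_eq
  rw [fderiv_clm_apply (differentiableAt_of_smooth (contDiffOn_fderiv hu) hx)
    differentiableAt_fun_id] at h2
  have h3 : fderiv ℝ (fderiv ℝ u) x (e3 i) x = ∑ j, hess3 u x i j * x j := by
    refine (congrArg (fderiv ℝ (fderiv ℝ u) x (e3 i)) (eq_sum_smul_e3 x)).trans ?_
    simp [hess3_apply, mul_comm]
  rw [← h3]
  simp at h2
  unfold grad3
  linarith

/-- The projected Hessian of a degree-0 homogeneous function on the unit sphere. -/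
lemma Homog0.hessS_apply {u : E3 → ℝ} (hu0 : Homog0 u)
    (hu : ContDiffOn ℝ (⊤ : ℕ∞) u {(0 : E3)}ᶜ) {x : E3} (hx : x ≠ 0) (i j : Fin 3) :
    hessS u x i j = hess3 u x i j + x i * grad3 u x j + grad3 u x i * x j := by
  have h0 := hu0.sum_grad3 hu hx
  have hA (k : Fin 3) := hu0.sum_hess3 hu hx k
  have hs (k l : Fin 3) := hess3_comm hu hx k l
  have hleft (k : Fin 3) : (proj3 x * hess3 u x) i k = hess3 u x i k + x i * grad3 u x k := by
    have h := hA k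
    simp only [Fin.sum_univ_three, hs k] at h
    rw [proj3, sub_mul, one_mul, Matrix.sub_apply, Matrix.mul_apply]
    simp only [Matrix.of_apply, Fin.sum_univ_three]
    linear_combination (-x i) * h
  have h := hA i
  simp only [Fin.sum_univ_three] at h h0
  rw [hessS]
  nth_rw 2 [proj3]
  rw [mul_sub, mul_one, Matrix.sub_apply, Matrix.mul_apply (N := Matrix.of _)]
  simp only [hleft, Matrix.of_apply, Fin.sum_univ_three]
  linear_combination (-x j) * h - x i * x j * h0

/-- The Poisson bracket `x · (∇f × ∇g)` of the sphere. -/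
def sphereBracket (f g : E3 → ℝ) (x : E3) : ℝ := dot3 x (cross3 (grad3 f x) (grad3 g x))

lemma sphereBracket_eq_fderiv_rotGen {f g : E3 → ℝ} (hf : ContDiffOn ℝ (⊤ : ℕ∞) f {(0 : E3)}ᶜ)
    (hg : ContDiffOn ℝ (⊤ : ℕ∞) g {(0 : E3)}ᶜ) {x : E3} (hx : x ≠ 0) :
    sphereBracket f g x = ∑ k : Fin 3,
      fderiv ℝ (fun y => f y * grad3 g y k) x (rotGen (k + 1) (k + 2) x) := by
  have hd (k : Fin 3) := grad3_mul (differentiableAt_of_smooth hf hx)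
    (differentiableAt_of_smooth (contDiffOn_grad3 hg k) hx)
  simp only [fderiv_rotGen, hd, grad3_grad3 hg hx, Fin.sum_univ_three, sphereBracket, dot3, cross3]
  simp
  rw [hess3_comm hg hx 1 0, hess3_comm hg hx 2 0, hess3_comm hg hx 2 1]
  ring

lemma integrableOn_and_integral_sphereBracket {f g : E3 → ℝ}
    (hf : ContDiffOn ℝ (⊤ : ℕ∞) f {(0 : E3)}ᶜ) (hg : ContDiffOn ℝ (⊤ : ℕ∞) g {(0 : E3)}ᶜ) :
    IntegrableOn (sphereBracket f g) (sphere (0 : E3) 1) μH[2] ∧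
      ∫ x in sphere (0 : E3) 1, sphereBracket f g x ∂μH[2] = 0 := by
  have hc (k : Fin 3) : ContDiffOn ℝ 1 (fun y => f y * grad3 g y k) {(0 : E3)}ᶜ :=
    (hf.mul (contDiffOn_grad3 hg k)).of_le (by simp)
  have hi (k : Fin 3) := integrableOn_sphere (continuousOn_fderiv_rotGen (hc k) (k + 1) (k + 2))
  have heq : Set.EqOn (sphereBracket f g) (fun x => ∑ k : Fin 3,
      fderiv ℝ (fun y => f y * grad3 g y k) x (rotGen (k + 1) (k + 2) x)) (sphere (0 : E3) 1) :=
    fun x hx => sphereBracket_eq_fderiv_rotGen hf hg (ne_zero_of_mem_sphere_one hx)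
  constructor
  · exact IntegrableOn.congr_fun (integrable_finsetSum _ fun k _ => hi k) heq.symm
      isClosed_sphere.measurableSet
  · rw [setIntegral_congr_fun isClosed_sphere.measurableSet heq,
      integral_finsetSum _ fun k _ => hi k]
    exact Finset.sum_eq_zero fun k _ => integral_fderiv_rotGen (hc k) _ _

lemma trace_crossMat_hessS_hessS {u v : E3 → ℝ} (hu : ContDiffOn ℝ (⊤ : ℕ∞) u {(0 : E3)}ᶜ)
    (hv : ContDiffOn ℝ (⊤ : ℕ∞) v {(0 : E3)}ᶜ) (hu0 : Homog0 u) (hv0 : Homog0 v) {x : E3}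
    (hx : x ∈ sphere (0 : E3) 1) :
    (crossMat x * hessS u x * hessS v x).trace =
      ∑ m, sphereBracket (fun y => grad3 u y m) (fun y => grad3 v y m) x
        - sphereBracket u v x := by
  have hx0 := ne_zero_of_mem_sphere_one hx
  have hn := sum_sq_of_mem_sphere hx
  have hA (k : Fin 3) := hu0.sum_hess3 hu hx0 k
  have hB (k : Fin 3) := hv0.sum_hess3 hv hx0 k
  simp only [Fin.sum_univ_three] at hA hB
  have hA0 := hA 0
  have hA1 := hA 1
  have hA2 := hA 2
  have hB0 := hB 0
  have hB1 := hB 1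
  have hB2 := hB 2
  simp only [Matrix.trace, Matrix.diag, Matrix.mul_apply, hu0.hessS_apply hu hx0,
    hv0.hessS_apply hv hx0, sphereBracket, dot3, cross3, Fin.sum_univ_three,
    grad3_grad3 hu hx0, grad3_grad3 hv hx0, crossMat]
  simp
  simp only [hess3_comm hu hx0 1 0, hess3_comm hu hx0 2 0, hess3_comm hu hx0 2 1,
    hess3_comm hv hx0 1 0, hess3_comm hv hx0 2 0, hess3_comm hv hx0 2 1] at *
  generalize grad3 u x = a at *
  generalize grad3 v x = b at *
  linear_combination
    -(x 1 * b 2 - x 2 * b 1) * hA0 - (x 2 * b 0 - x 0 * b 2) * hA1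
    - (x 0 * b 1 - x 1 * b 0) * hA2
    + (x 1 * a 2 - x 2 * a 1) * hB0 + (x 2 * a 0 - x 0 * a 2) * hB1
    + (x 0 * a 1 - x 1 * a 0) * hB2
    + (b 0 * (x 1 * a 2 - x 2 * a 1) + b 1 * (x 2 * a 0 - x 0 * a 2)
      + b 2 * (x 0 * a 1 - x 1 * a 0)) * hn

/-- for smooth degree-0 homogeneous u, v on ℝ³∖{0},
∫_{S²} tr(J_x H_u H_v) dS = 0. -/
theorem integral_hessian_cross_contraction_zero (u v : E3 → ℝ)
    (hu : ContDiffOn ℝ (⊤ : ℕ∞) u {(0:E3)}ᶜ) (hv : ContDiffOn ℝ (⊤ : ℕ∞) v {(0:E3)}ᶜ)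
    (hu0 : Homog0 u) (hv0 : Homog0 v) :
    ∫ x in Metric.sphere (0:E3) 1,
      (crossMat x * hessS u x * hessS v x).trace ∂(μH[2]) = 0 := by
  have hm (m : Fin 3) := integrableOn_and_integral_sphereBracket (contDiffOn_grad3 hu m)
    (contDiffOn_grad3 hv m)
  have huv := integrableOn_and_integral_sphereBracket hu hv
  rw [setIntegral_congr_fun Metric.isClosed_sphere.measurableSet
    fun x hx => trace_crossMat_hessS_hessS hu hv hu0 hv0 hx,
    integral_sub (integrable_finsetSum _ fun m _ => (hm m).1) huv.1,
    integral_finsetSum _ fun m _ => (hm m).1, huv.2, sub_zero]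
  exact Finset.sum_eq_zero fun m _ => (hm m).2
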